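/- For every irrational number x with 0 < x < 1 there exists a unique sequence (q_k)_{k≥1} of positive integers satisfying q_{k+1} ≥ q_k(q_k+1) for all k ≥ 1 such that x = ∑_{k=1}^∞ (−1)^{k+1}/q_k. -/

import Mathlib

open Filter Topology

/-- A sequence of positive integers with `q_{k+1} ≥ q_k (q_k + 1)`. -/
structure IsSecondOstrogradsky (q : ℕ → ℕ) : Prop where
  pos : ∀ k, 0 < q k
  mul_succ_le : ∀ k, q k * (q k + 1) ≤ q (k + 1)

namespace IsSecondOstrogradsky

variable {q : ℕ → ℕ}

theorem shift (hq : IsSecondOstrogradsky q) : IsSecondOstrogradsky fun k => q (k + 1) :=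
  ⟨fun k => hq.pos (k + 1), fun k => hq.mul_succ_le (k + 1)⟩

theorem two_pow_le (hq : IsSecondOstrogradsky q) (k : ℕ) : 2 ^ k ≤ q k := by
  induction k with
  | zero => exact hq.pos 0
  | succ k ih =>
    have h1 := hq.pos k
    have h2 := hq.mul_succ_le k
    rw [pow_succ]
    nlinarith

theorem inv_le (hq : IsSecondOstrogradsky q) (k : ℕ) : 1 / (q k : ℝ) ≤ (1 / 2) ^ k := by
  rw [one_div_pow]
  exact one_div_le_one_div_of_le (by positivity) (mod_cast hq.two_pow_le k)

theorem summable (hq : IsSecondOstrogradsky q) :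
    Summable fun k : ℕ => (-1 : ℝ) ^ k / (q k : ℝ) := by
  refine Summable.of_norm_bounded (summable_geometric_two) fun k => ?_
  simpa using hq.inv_le k

theorem antitone_inv (hq : IsSecondOstrogradsky q) : Antitone fun k => 1 / (q k : ℝ) := by
  refine antitone_nat_of_succ_le fun k => ?_
  have h1 := hq.pos k
  have h2 := hq.mul_succ_le k
  refine one_div_le_one_div_of_le (mod_cast h1) (mod_cast ?_)
  nlinarith

theorem nonneg_of_hasSum (hq : IsSecondOstrogradsky q) {x : ℝ}
    (h : HasSum (fun k : ℕ => (-1 : ℝ) ^ k / (q k : ℝ)) x) : 0 ≤ x := by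
  have ht : Tendsto (fun n => ∑ i ∈ Finset.range n, (-1 : ℝ) ^ i * (1 / (q i : ℝ)))
      atTop (𝓝 x) := by
    simpa only [mul_one_div] using h.tendsto_sum_nat
  simpa using hq.antitone_inv.alternating_series_le_tendsto ht 0

theorem hasSum_shift {x : ℝ}
    (h : HasSum (fun k : ℕ => (-1 : ℝ) ^ k / (q k : ℝ)) x) :
    HasSum (fun k : ℕ => (-1 : ℝ) ^ k / (q (k + 1) : ℝ)) (1 / (q 0 : ℝ) - x) := by
  have h1 := ((hasSum_nat_add_iff' 1).2 h).neg
  simp only [Finset.range_one, Finset.sum_singleton, pow_zero, neg_sub] at h1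
  have e : (fun k : ℕ => (-1 : ℝ) ^ k / (q (k + 1) : ℝ)) =
      fun k => -((-1 : ℝ) ^ (k + 1) / (q (k + 1) : ℝ)) := by
    funext k
    ring
  rwa [e]

theorem le_inv_of_hasSum (hq : IsSecondOstrogradsky q) {x : ℝ}
    (h : HasSum (fun k : ℕ => (-1 : ℝ) ^ k / (q k : ℝ)) x) : x ≤ 1 / (q 0 : ℝ) :=
  sub_nonneg.1 (hq.shift.nonneg_of_hasSum (hasSum_shift h))

theorem inv_succ_le_of_hasSum (hq : IsSecondOstrogradsky q) {x : ℝ}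
    (h : HasSum (fun k : ℕ => (-1 : ℝ) ^ k / (q k : ℝ)) x) : 1 / ((q 0 : ℝ) + 1) ≤ x := by
  have h1 := hq.shift.le_inv_of_hasSum (hasSum_shift h)
  have h0 : (0 : ℝ) < q 0 := mod_cast hq.pos 0
  have h2 : 1 / (q (0 + 1) : ℝ) ≤ 1 / ((q 0 : ℝ) * (q 0 + 1)) :=
    one_div_le_one_div_of_le (by positivity) (mod_cast hq.mul_succ_le 0)
  have h3 : 1 / ((q 0 : ℝ) * (q 0 + 1)) = 1 / (q 0 : ℝ) - 1 / ((q 0 : ℝ) + 1) := by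
    field_simp
    ring
  linarith

theorem floor_inv_eq_of_hasSum (hq : IsSecondOstrogradsky q) {x : ℝ} (hx : Irrational x)
    (h : HasSum (fun k : ℕ => (-1 : ℝ) ^ k / (q k : ℝ)) x) : ⌊1 / x⌋₊ = q 0 := by
  have h0 : (0 : ℝ) < q 0 := mod_cast hq.pos 0
  have hpos : 0 < x := lt_of_lt_of_le (by positivity) (hq.inv_succ_le_of_hasSum h)
  have hne : 1 / ((q 0 : ℝ) + 1) ≠ x := by
    intro e
    exact hx.ne_rat (1 / ((q 0 : ℚ) + 1)) (by push_cast; exact e.symm)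
  have hlt := lt_of_le_of_ne (hq.inv_succ_le_of_hasSum h) hne
  rw [Nat.floor_eq_iff (by positivity)]
  exact ⟨(le_one_div hpos h0).1 (hq.le_inv_of_hasSum h),
    (one_div_lt (by positivity) hpos).1 hlt⟩

theorem eq_of_hasSum {p q : ℕ → ℕ} (hp : IsSecondOstrogradsky p) (hq : IsSecondOstrogradsky q)
    {x : ℝ} (hx : Irrational x)
    (h : HasSum (fun k : ℕ => (-1 : ℝ) ^ k / (p k : ℝ)) x)
    (h' : HasSum (fun k : ℕ => (-1 : ℝ) ^ k / (q k : ℝ)) x) (n : ℕ) : p n = q n := by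
  have e : p 0 = q 0 :=
    (hp.floor_inv_eq_of_hasSum hx h).symm.trans (hq.floor_inv_eq_of_hasSum hx h')
  induction n generalizing p q x with
  | zero => exact e
  | succ n ih =>
    have hs := hasSum_shift h
    have hs' := hasSum_shift h'
    rw [← e] at hs'
    have hx' : Irrational (1 / (p 0 : ℝ) - x) := by
      simpa using hx.ratCast_sub (1 / (p 0 : ℚ))
    exact ih hp.shift hq.shift hx' hs hs' ((hp.shift.floor_inv_eq_of_hasSum hx' hs).symm.trans
      (hq.shift.floor_inv_eq_of_hasSum hx' hs'))

end IsSecondOstrogradsky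

/-- The remainders of the greedy expansion: `x₀ = x` and `x_{k+1} = 1 / ⌊1 / x_k⌋ - x_k`. -/
noncomputable def ostrogradskyRemainder (x : ℝ) : ℕ → ℝ
  | 0 => x
  | k + 1 => 1 / (⌊1 / ostrogradskyRemainder x k⌋₊ : ℝ) - ostrogradskyRemainder x k

/-- The digits `⌊1 / x_k⌋` of the greedy expansion. -/
noncomputable def ostrogradskyDigit (x : ℝ) (k : ℕ) : ℕ := ⌊1 / ostrogradskyRemainder x k⌋₊

theorem ostrogradskyRemainder_succ (x : ℝ) (k : ℕ) :
    ostrogradskyRemainder x (k + 1) =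
      1 / (ostrogradskyDigit x k : ℝ) - ostrogradskyRemainder x k := rfl

theorem one_le_floor_one_div {y : ℝ} (h0 : 0 < y) (h1 : y < 1) : 1 ≤ ⌊1 / y⌋₊ :=
  Nat.le_floor (by simpa using (one_lt_one_div h0 h1).le)

theorem lt_one_div_floor {y : ℝ} (hy : Irrational y) (h0 : 0 < y) (h1 : y < 1) :
    y < 1 / (⌊1 / y⌋₊ : ℝ) := by
  have hf : (0 : ℝ) < ⌊1 / y⌋₊ := mod_cast one_le_floor_one_div h0 h1
  refine lt_of_le_of_ne ((le_one_div h0 hf).2 (Nat.floor_le (by positivity))) fun e => ?_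
  exact hy.ne_rat (1 / (⌊1 / y⌋₊ : ℚ)) (by push_cast; exact e)

theorem one_div_floor_sub_lt {y : ℝ} (h0 : 0 < y) (h1 : y < 1) :
    1 / (⌊1 / y⌋₊ : ℝ) - y < 1 / ((⌊1 / y⌋₊ : ℝ) * (⌊1 / y⌋₊ + 1)) := by
  have hf : (0 : ℝ) < ⌊1 / y⌋₊ := mod_cast one_le_floor_one_div h0 h1
  have h2 : 1 / ((⌊1 / y⌋₊ : ℝ) + 1) < y :=
    (one_div_lt (by positivity) h0).2 (Nat.lt_floor_add_one _)
  have h3 : 1 / ((⌊1 / y⌋₊ : ℝ) * (⌊1 / y⌋₊ + 1)) =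
      1 / (⌊1 / y⌋₊ : ℝ) - 1 / ((⌊1 / y⌋₊ : ℝ) + 1) := by
    field_simp
    ring
  linarith

theorem ostrogradskyRemainder_mem {x : ℝ} (hx : Irrational x) (hx0 : 0 < x) (hx1 : x < 1)
    (k : ℕ) : Irrational (ostrogradskyRemainder x k) ∧ 0 < ostrogradskyRemainder x k ∧
      ostrogradskyRemainder x k < 1 := by
  induction k with
  | zero => exact ⟨hx, hx0, hx1⟩
  | succ k ih =>
    obtain ⟨hi, h0, h1⟩ := ih
    have hf : (1 : ℝ) ≤ ⌊1 / ostrogradskyRemainder x k⌋₊ := mod_cast one_le_floor_one_div h0 h1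
    refine ⟨?_, sub_pos.2 (lt_one_div_floor hi h0 h1),
      (one_div_floor_sub_lt h0 h1).trans_le ?_⟩
    · simpa [ostrogradskyRemainder] using
        hi.ratCast_sub (1 / (⌊1 / ostrogradskyRemainder x k⌋₊ : ℚ))
    · rw [div_le_one (by positivity)]
      nlinarith

theorem isSecondOstrogradsky_ostrogradskyDigit {x : ℝ} (hx : Irrational x) (hx0 : 0 < x)
    (hx1 : x < 1) : IsSecondOstrogradsky (ostrogradskyDigit x) where
  pos k := by
    obtain ⟨-, h0, h1⟩ := ostrogradskyRemainder_mem hx hx0 hx1 k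
    exact one_le_floor_one_div h0 h1
  mul_succ_le k := by
    obtain ⟨-, h0, h1⟩ := ostrogradskyRemainder_mem hx hx0 hx1 k
    obtain ⟨-, h0', -⟩ := ostrogradskyRemainder_mem hx hx0 hx1 (k + 1)
    have hf : (0 : ℝ) < ⌊1 / ostrogradskyRemainder x k⌋₊ := mod_cast one_le_floor_one_div h0 h1
    refine Nat.le_floor ?_
    push_cast
    refine (le_one_div (mul_pos hf (by positivity)) h0').2 ?_
    exact (one_div_floor_sub_lt h0 h1).le

theorem sum_ostrogradskyDigit (x : ℝ) (n : ℕ) :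
    ∑ k ∈ Finset.range n, (-1 : ℝ) ^ k / (ostrogradskyDigit x k : ℝ) =
      x - (-1) ^ n * ostrogradskyRemainder x n := by
  induction n with
  | zero => simp [ostrogradskyRemainder]
  | succ n ih =>
    rw [Finset.sum_range_succ, ih, ostrogradskyRemainder_succ]
    ring

theorem hasSum_ostrogradskyDigit {x : ℝ} (hx : Irrational x) (hx0 : 0 < x) (hx1 : x < 1) :
    HasSum (fun k : ℕ => (-1 : ℝ) ^ k / (ostrogradskyDigit x k : ℝ)) x := by
  have hq := isSecondOstrogradsky_ostrogradskyDigit hx hx0 hx1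
  rw [hq.summable.hasSum_iff_tendsto_nat]
  simp only [sum_ostrogradskyDigit]
  have h : Tendsto (fun n => (-1 : ℝ) ^ n * ostrogradskyRemainder x n) atTop (𝓝 0) := by
    refine squeeze_zero_norm (fun n => ?_)
      (tendsto_pow_atTop_nhds_zero_of_lt_one (r := (1 / 2 : ℝ)) (by norm_num) (by norm_num))
    obtain ⟨hi, h0, h1⟩ := ostrogradskyRemainder_mem hx hx0 hx1 n
    rw [norm_mul, norm_pow, norm_neg, norm_one, one_pow, one_mul, Real.norm_of_nonneg h0.le]
    exact (lt_one_div_floor hi h0 h1).le.trans (hq.inv_le n)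
  simpa using h.const_sub x

/-- For every irrational number `x` with `0 < x < 1` there exists a unique
second Ostrogradsky sequence `(q_k)_{k ≥ 1}` (here indexed by `ℕ` starting from `0`, so `q k`
stands for `q_{k+1}`), i.e. a sequence of positive integers with `q_{k+1} ≥ q_k (q_k + 1)`,
such that `x = ∑_{k=1}^∞ (-1)^{k+1} / q_k`. -/
theorem second_ostrogradsky_expansion_exists_unique
    (x : ℝ) (hx : Irrational x) (hx0 : 0 < x) (hx1 : x < 1) :
    ∃! q : ℕ → ℕ,
      (∀ k, 0 < q k) ∧ (∀ k, q k * (q k + 1) ≤ q (k + 1)) ∧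
        x = ∑' k : ℕ, (-1 : ℝ) ^ k / (q k : ℝ) := by
  have hd := isSecondOstrogradsky_ostrogradskyDigit hx hx0 hx1
  have hs := hasSum_ostrogradskyDigit hx hx0 hx1
  refine ⟨ostrogradskyDigit x, ⟨hd.pos, hd.mul_succ_le, hs.tsum_eq.symm⟩, ?_⟩
  rintro p ⟨hpos, hmul, hsum⟩
  have hp : IsSecondOstrogradsky p := ⟨hpos, hmul⟩
  exact funext (hp.eq_of_hasSum hd hx (hsum ▸ hp.summable.hasSum) hs)
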